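/- There exist a complex Hilbert space H and an operator Q ∈ B(H) such that Q is s.o.t.-quasinilpotent, the spectrum σ(Q) is contained in the real line ℝ (viewed inside ℂ), and the spectral radius of Q is at least 1; in particular Q is s.o.t.-quasinilpotent but not quasinilpotent. (In the paper, such Q is constructed inside the hyperfinite II_1-factor as a direct sum of nilpotent Toeplitz matrices, and its spectrum is a nondegenerate real interval.) -/

import Mathlib

open Filter Topology

/-- The element `|T^n|^{1/n} = ((T^n)^* T^n)^{1/(2n)}`, defined via the continuous
functional calculus. -/
noncomputable def absPowRoot {A : Type*} [CStarAlgebra A] [PartialOrder A] [StarOrderedRing A]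
    (T : A) (n : ℕ) : A :=
  CFC.rpow (star (T ^ n) * T ^ n) ((2 * n : ℝ))⁻¹

/-- An operator `Q ∈ B(H)` is s.o.t.-quasinilpotent if `|Q^n|^{1/n} → 0` in the strong
operator topology. -/
def SOTQuasinilpotent {H : Type*} [NormedAddCommGroup H] [InnerProductSpace ℂ H]
    [CompleteSpace H] (Q : H →L[ℂ] H) : Prop :=
  ∀ x : H, Tendsto (fun n : ℕ => ‖absPowRoot Q n x‖) atTop (𝓝 0)

section SQ
variable {H : Type*} [NormedAddCommGroup H] [InnerProductSpace ℂ H] [CompleteSpace H]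

lemma absPowRoot_selfAdjoint (Q : H →L[ℂ] H) (n : ℕ) : IsSelfAdjoint (absPowRoot Q n) :=
  IsSelfAdjoint.of_nonneg CFC.rpow_nonneg

lemma absPowRoot_pow (Q : H →L[ℂ] H) {n : ℕ} (hn : n ≠ 0) :
    absPowRoot Q n ^ (2 * n) = star (Q ^ n) * Q ^ n := by
  have h0 : (0 : H →L[ℂ] H) ≤ star (Q ^ n) * Q ^ n := star_mul_self_nonneg _
  have h1 : (0 : H →L[ℂ] H) ≤ absPowRoot Q n := CFC.rpow_nonneg
  rw [← CFC.rpow_natCast _ _ h1]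
  unfold absPowRoot
  rw [CFC.rpow_eq_pow, CFC.rpow_rpow_of_exponent_nonneg _ _ _ (by positivity) (by positivity) h0]
  have : ((2 * n : ℝ))⁻¹ * ((2 * n : ℕ) : ℝ) = 1 := by
    push_cast
    field_simp
  rw [this, CFC.rpow_one _ h0]

lemma selfAdjoint_pow_apply_eq_zero (r : H →L[ℂ] H) (hr : IsSelfAdjoint r) (x : H) (n : ℕ)
    (h : (r ^ n) x = 0) (hn : n ≠ 0) : r x = 0 := by
  have step : ∀ m : ℕ, m ≠ 0 → (r ^ (m+1)) x = 0 → (r ^ m) x = 0 := by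
    intro m hm h
    obtain ⟨k, rfl⟩ := Nat.exists_eq_succ_of_ne_zero hm
    have hs := (ContinuousLinearMap.isSelfAdjoint_iff_isSymmetric.1 hr)
    have : inner ℂ ((r ^ (k+1)) x) ((r ^ (k+1)) x) = (0 : ℂ) := by
      have e : (r ^ (k+1)) x = r ((r ^ k) x) := by rw [pow_succ']; rfl
      have e2 : (r ^ (k+1+1)) x = r ((r ^ (k+1)) x) := by rw [pow_succ']; rfl
      nth_rw 1 [e]
      have := hs ((r ^ k) x) ((r ^ (k+1)) x)
      simp only [ContinuousLinearMap.coe_coe] at this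
      rw [this, ← e2, h, inner_zero_right]
    exact inner_self_eq_zero.1 this
  induction n with
  | zero => exact absurd rfl hn
  | succ n ih =>
    rcases Nat.eq_zero_or_pos n with rfl | hp
    · simpa using h
    · exact ih (step n hp.ne' h) hp.ne'

lemma absPowRoot_norm_le (Q : H →L[ℂ] H) {n : ℕ} (hn : n ≠ 0) :
    ‖absPowRoot Q n‖ ≤ ‖Q‖ := by
  have h0 : (0 : H →L[ℂ] H) ≤ star (Q ^ n) * Q ^ n := star_mul_self_nonneg _
  have : ‖absPowRoot Q n‖ = ‖star (Q ^ n) * Q ^ n‖ ^ ((2 * n : ℝ))⁻¹ := by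
    exact CFC.norm_rpow _ (by positivity) h0
  rw [this, CStarRing.norm_star_mul_self]
  have h1 : ‖Q ^ n‖ ≤ ‖Q‖ ^ n := norm_pow_le' _ (Nat.pos_of_ne_zero hn)
  calc (‖Q ^ n‖ * ‖Q ^ n‖) ^ ((2 * n : ℝ))⁻¹ ≤ (‖Q‖ ^ (2 * n)) ^ ((2 * n : ℝ))⁻¹ := by
        gcongr
        rw [two_mul, pow_add]
        gcongr
    _ = ‖Q‖ := by
        have := Real.pow_rpow_inv_natCast (norm_nonneg Q) (n := 2 * n) (by omega)
        push_cast at this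
        exact this

lemma absPowRoot_apply_eq_zero (Q : H →L[ℂ] H) {n : ℕ} (hn : n ≠ 0) (x : H)
    (h : (Q ^ n) x = 0) : absPowRoot Q n x = 0 := by
  apply selfAdjoint_pow_apply_eq_zero _ (absPowRoot_selfAdjoint Q n) x (2 * n) _ (by omega)
  rw [absPowRoot_pow Q hn]
  simp [h]

lemma sotQuasinilpotent_of_dense (Q : H →L[ℂ] H)
    (h : Dense {x : H | ∃ m, (Q ^ m) x = 0}) : SOTQuasinilpotent Q := by
  intro x
  rw [Metric.tendsto_atTop]
  intro ε hε
  obtain ⟨y, ⟨m, hm⟩, hy⟩ := h.exists_dist_lt x (ε := ε / (‖Q‖ + 1)) (by positivity)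
  refine ⟨m + 1, fun n hn => ?_⟩
  have hn0 : n ≠ 0 := by omega
  have hy0 : (Q ^ n) y = 0 := by
    obtain ⟨k, rfl⟩ := Nat.exists_eq_add_of_le (show m ≤ n by omega)
    rw [add_comm, pow_add]
    simp [hm]
  have e : absPowRoot Q n x = absPowRoot Q n (x - y) := by
    rw [map_sub, absPowRoot_apply_eq_zero Q hn0 y hy0, sub_zero]
  rw [dist_zero_right, norm_norm, e]
  rw [dist_eq_norm, lt_div_iff₀ (by positivity)] at hy
  calc _ ≤ ‖absPowRoot Q n‖ * ‖x - y‖ := ContinuousLinearMap.le_opNorm _ _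
    _ ≤ ‖Q‖ * ‖x - y‖ := by gcongr; exact absPowRoot_norm_le Q hn0
    _ ≤ ‖x - y‖ * (‖Q‖ + 1) := by nlinarith [norm_nonneg (x - y)]
    _ < ε := hy
end SQ

section BD
variable {E : ℕ → Type} [∀ n, NormedAddCommGroup (E n)] [∀ n, InnerProductSpace ℂ (E n)]

lemma bd_mem (T : ∀ n, E n →L[ℂ] E n) (C : ℝ) (hT : ∀ n, ‖T n‖ ≤ C)
    (x : lp E 2) : Memℓp (fun n => T n (x n)) 2 := by
  have hC : 0 ≤ C := (norm_nonneg _).trans (hT 0)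
  have hx := (memℓp_gen_iff (p := 2) (by simp)).1 (lp.memℓp x)
  apply memℓp_gen
  simp only [ENNReal.toReal_ofNat, Real.rpow_ofNat] at hx ⊢
  refine Summable.of_nonneg_of_le (fun _ => by positivity) (fun n => ?_) (hx.mul_left (C ^ 2))
  rw [← mul_pow]
  gcongr
  exact ((T n).le_opNorm _).trans (by gcongr; exact hT n)

/-- Block diagonal operator. -/
noncomputable def bd (T : ∀ n, E n →L[ℂ] E n) (C : ℝ) (hT : ∀ n, ‖T n‖ ≤ C) :
    lp E 2 →L[ℂ] lp E 2 :=
  LinearMap.mkContinuous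
    { toFun := fun x => ⟨fun n => T n (x n), bd_mem T C hT x⟩
      map_add' := fun x y => by
        ext n
        exact map_add (T n) (x n) (y n)
      map_smul' := fun c x => by
        ext n
        exact map_smul (T n) c (x n) } C (fun x => by
    have hC : 0 ≤ C := (norm_nonneg _).trans (hT 0)
    apply lp.norm_le_of_forall_sum_le (by simp) (by positivity)
    intro s
    have h := lp.sum_rpow_le_norm_rpow (p := 2) (by simp) x s
    simp only [ENNReal.toReal_ofNat, Real.rpow_ofNat, LinearMap.coe_mk, AddHom.coe_mk] at h ⊢
    calc ∑ i ∈ s, ‖T i (x i)‖ ^ 2 ≤ ∑ i ∈ s, C ^ 2 * ‖x i‖ ^ 2 := by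
          gcongr with i hi
          rw [← mul_pow]
          gcongr
          exact ((T i).le_opNorm _).trans (by gcongr; exact hT i)
      _ = C ^ 2 * ∑ i ∈ s, ‖x i‖ ^ 2 := by rw [Finset.mul_sum]
      _ ≤ (C * ‖x‖) ^ 2 := by rw [mul_pow]; gcongr)

@[simp] lemma bd_apply (T : ∀ n, E n →L[ℂ] E n) (C : ℝ) (hT : ∀ n, ‖T n‖ ≤ C) (x : lp E 2)
    (n : ℕ) : (bd T C hT x : ∀ n, E n) n = T n (x n) := rfl

lemma bd_pow_apply (T : ∀ n, E n →L[ℂ] E n) (C : ℝ) (hT : ∀ n, ‖T n‖ ≤ C) (x : lp E 2)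
    (m n : ℕ) : ((bd T C hT ^ m) x : ∀ n, E n) n = (T n ^ m) (x n) := by
  induction m with
  | zero => simp
  | succ m ih =>
    rw [pow_succ', pow_succ']
    change T n (((bd T C hT ^ m) x : ∀ n, E n) n) = T n ((T n ^ m) (x n))
    rw [ih]

lemma le_norm_bd_pow (T : ∀ n, E n →L[ℂ] E n) (C : ℝ) (hT : ∀ n, ‖T n‖ ≤ C) (m n : ℕ) :
    ‖T n ^ m‖ ≤ ‖bd T C hT ^ m‖ := by
  refine ContinuousLinearMap.opNorm_le_bound _ (ContinuousLinearMap.opNorm_nonneg _) (fun y => ?_)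
  have h1 := (bd T C hT ^ m).le_opNorm (lp.single 2 n y)
  rw [lp.norm_single (by simp)] at h1
  have h2 := lp.norm_apply_le_norm (p := 2) (by simp) ((bd T C hT ^ m) (lp.single 2 n y)) n
  rw [bd_pow_apply, lp.single_apply_self] at h2
  exact h2.trans h1

lemma bd_dense (T : ∀ n, E n →L[ℂ] E n) (C : ℝ) (hT : ∀ n, ‖T n‖ ≤ C)
    (hnil : ∀ n, T n ^ n = 0) : Dense {x : lp E 2 | ∃ m, (bd T C hT ^ m) x = 0} := by
  intro x
  have h := lp.hasSum_single (p := 2) (by simp) x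
  refine mem_closure_of_tendsto h (Eventually.of_forall fun s => ?_)
  obtain ⟨M, hM⟩ := s.exists_nat_subset_range
  refine ⟨M, ?_⟩
  rw [map_sum]
  refine Finset.sum_eq_zero fun i hi => ?_
  have hi' : i < M := by simpa using hM hi
  ext n
  rw [bd_pow_apply]
  by_cases hn : n = i
  · subst hn
    have : T n ^ M = 0 := pow_eq_zero_of_le hi'.le (hnil n)
    rw [this]; simp
  · rw [lp.single_apply_ne _ _ _ hn]; simp

lemma resolvent_bound {F : Type*} [NormedAddCommGroup F] [InnerProductSpace ℂ F] [CompleteSpace F]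
    (T : F →L[ℂ] F) (z : ℂ) (ε : ℝ) (h : ‖T - star T‖ ≤ ε) (x : F) :
    (|z.im| - ε / 2) * ‖x‖ ≤ ‖z • x - T x‖ := by
  have key : (|z.im| - ε / 2) * ‖x‖ ^ 2 ≤ ‖z • x - T x‖ * ‖x‖ := by
    have h1 : ‖(inner ℂ x (z • x - T x) : ℂ)‖ ≤ ‖x‖ * ‖z • x - T x‖ := norm_inner_le_norm _ _
    have h2 : |(inner ℂ x (z • x - T x) : ℂ).im| ≤ ‖(inner ℂ x (z • x - T x) : ℂ)‖ :=
      Complex.abs_im_le_norm _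
    have h3 : (inner ℂ x (z • x - T x) : ℂ).im = z.im * ‖x‖ ^ 2 - (inner ℂ x (T x) : ℂ).im := by
      rw [inner_sub_right, inner_smul_right, inner_self_eq_norm_sq_to_K, Complex.sub_im]
      congr 1
      have e : ((‖x‖ : ℂ) ^ 2) = ((‖x‖ ^ 2 : ℝ) : ℂ) := by push_cast; rfl
      change (z * (‖x‖ : ℂ) ^ 2).im = _
      rw [e, Complex.im_mul_ofReal]
    have h4 : 2 * |(inner ℂ x (T x) : ℂ).im| ≤ ε * ‖x‖ ^ 2 := by
      have e : (inner ℂ x ((T - star T) x) : ℂ) = 2 * (inner ℂ x (T x) : ℂ).im * Complex.I := by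
        rw [sub_apply, inner_sub_right, ContinuousLinearMap.star_eq_adjoint,
          ContinuousLinearMap.adjoint_inner_right, ← inner_conj_symm (T x) x, Complex.sub_conj]
        push_cast; ring
      have e2 := congrArg norm e
      have : ‖(inner ℂ x ((T - star T) x) : ℂ)‖ ≤ ‖x‖ * (ε * ‖x‖) :=
        (norm_inner_le_norm _ _).trans (by
          gcongr
          exact ((T - star T).le_opNorm x).trans (by gcongr))
      rw [e2] at this
      simp at this
      nlinarith
    have h5 : |z.im| * ‖x‖ ^ 2 ≤ |(inner ℂ x (z • x - T x) : ℂ).im| +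
        |(inner ℂ x (T x) : ℂ).im| := by
      rw [h3]
      have := abs_add_le (z.im * ‖x‖ ^ 2 - (inner ℂ x (T x) : ℂ).im) (inner ℂ x (T x) : ℂ).im
      rw [sub_add_cancel, abs_mul, abs_of_nonneg (sq_nonneg ‖x‖)] at this
      exact this
    nlinarith
  rcases eq_or_ne x 0 with rfl | hx
  · simp
  · have : 0 < ‖x‖ := norm_pos_iff.2 hx
    nlinarith

variable [∀ n, CompleteSpace (E n)]

lemma bd_spectrum (T : ∀ n, E n →L[ℂ] E n) (C : ℝ) (hT : ∀ n, ‖T n‖ ≤ C)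
    (hnil : ∀ n, T n ^ n = 0) (hsa : Tendsto (fun n => ‖T n - star (T n)‖) atTop (𝓝 0))
    (z : ℂ) (hz : z ∈ spectrum ℂ (bd T C hT)) : z.im = 0 := by
  by_contra him
  apply hz
  have hz0 : z ≠ 0 := by rintro rfl; simp at him
  have hpos : 0 < |z.im| := abs_pos.2 him
  -- each block is invertible
  have hunit : ∀ n, IsUnit (algebraMap ℂ (E n →L[ℂ] E n) z - T n) := by
    intro n
    have h1 : IsNilpotent (T n) := ⟨n, hnil n⟩
    have h2 : IsUnit (algebraMap ℂ (E n →L[ℂ] E n) z) := (IsUnit.mk0 z hz0).map _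
    rw [sub_eq_add_neg]
    exact h1.neg.isUnit_add_left_of_commute h2 (Algebra.commutes z (-T n)).symm
  choose U hU using hunit
  have hbound : ∃ D, ∀ n, ‖((U n)⁻¹ : (E n →L[ℂ] E n)ˣ).val‖ ≤ D := by
    have hev : ∀ᶠ n in atTop, ‖((U n)⁻¹ : (E n →L[ℂ] E n)ˣ).val‖ ≤ 2 / |z.im| := by
      filter_upwards [hsa.eventually (gt_mem_nhds hpos)] with n hn
      refine ContinuousLinearMap.opNorm_le_bound _ (by positivity) fun y => ?_
      have h := resolvent_bound (T n) z _ hn.le (((U n)⁻¹ : (E n →L[ℂ] E n)ˣ).val y)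
      have e : z • (((U n)⁻¹ : (E n →L[ℂ] E n)ˣ).val y) -
          T n (((U n)⁻¹ : (E n →L[ℂ] E n)ˣ).val y) = y := by
        have := congrArg (fun A : E n →L[ℂ] E n => A y) (U n).mul_inv
        rw [hU n] at this
        simpa [Algebra.algebraMap_eq_smul_one] using this
      rw [e] at h
      rw [div_mul_eq_mul_div, le_div_iff₀ hpos]
      nlinarith
    obtain ⟨N, hN⟩ := eventually_atTop.1 hev
    refine ⟨2 / |z.im| + ∑ i ∈ Finset.range N, ‖((U i)⁻¹ : (E i →L[ℂ] E i)ˣ).val‖, fun n => ?_⟩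
    rcases le_or_gt N n with h | h
    · exact (hN n h).trans (le_add_of_nonneg_right (Finset.sum_nonneg fun _ _ => norm_nonneg _))
    · refine le_add_of_nonneg_of_le (by positivity) ?_
      exact Finset.single_le_sum (f := fun i => ‖((U i)⁻¹ : (E i →L[ℂ] E i)ˣ).val‖)
        (fun _ _ => norm_nonneg _) (Finset.mem_range.2 h)
  obtain ⟨D, hD⟩ := hbound
  refine isUnit_iff_exists.2 ⟨bd (fun n => ((U n)⁻¹ : (E n →L[ℂ] E n)ˣ).val) D hD, ?_, ?_⟩
  · ext x n
    have := congrArg (fun A : E n →L[ℂ] E n => A (x n)) (U n).mul_inv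
    rw [hU n] at this
    rw [Algebra.algebraMap_eq_smul_one] at this ⊢
    exact this
  · ext x n
    have := congrArg (fun A : E n →L[ℂ] E n => A (x n)) (U n).inv_mul
    rw [hU n] at this
    rw [Algebra.algebraMap_eq_smul_one] at this ⊢
    exact this

lemma norm_pow_mul_le_of_norm_le_one {A : Type*} [CStarAlgebra A] (S a : A) (h1 : ‖S‖ ≤ 1)
    (m : ℕ) : ‖S ^ m * a‖ ≤ ‖a‖ := by
  induction m with
  | zero => simp
  | succ m ih =>
    rw [pow_succ', mul_assoc]
    refine (norm_mul_le _ _).trans ?_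
    nlinarith [norm_nonneg (S ^ m * a), norm_nonneg S]

lemma norm_pow_sub_star {A : Type*} [CStarAlgebra A] (T : A) (h1 : ‖T‖ ≤ 1) (m : ℕ) :
    ‖T ^ m - star (T ^ m)‖ ≤ m * ‖T - star T‖ := by
  induction m with
  | zero => simp
  | succ m ih =>
    have e : T ^ (m + 1) - star (T ^ (m + 1)) =
        (T ^ m - star (T ^ m)) * T + (star T) ^ m * (T - star T) := by
      rw [star_pow, star_pow, pow_succ, pow_succ]
      noncomm_ring
    rw [e]
    have h2 := norm_pow_mul_le_of_norm_le_one (star T) (T - star T) (by rwa [norm_star]) m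
    have h3 := norm_mul_le (T ^ m - star (T ^ m)) T
    have h4 := norm_add_le ((T ^ m - star (T ^ m)) * T) ((star T) ^ m * (T - star T))
    push_cast
    nlinarith [norm_nonneg (T ^ m - star (T ^ m)), norm_nonneg T]

lemma norm_pow_two_pow_tendsto {A : ℕ → Type*} [∀ n, CStarAlgebra (A n)] (T : ∀ n, A n)
    (h1 : ∀ n, ‖T n‖ ≤ 1) (h2 : Tendsto (fun n => ‖T n‖) atTop (𝓝 1))
    (hsa : Tendsto (fun n => ‖T n - star (T n)‖) atTop (𝓝 0)) (k : ℕ) :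
    Tendsto (fun n => ‖T n ^ (2 ^ k)‖) atTop (𝓝 1) := by
  have hle : ∀ n k, ‖T n ^ (2 ^ k)‖ ≤ 1 := fun n k =>
    (norm_pow_le' _ (by positivity)).trans (pow_le_one₀ (norm_nonneg _) (h1 n))
  induction k with
  | zero => simpa using h2
  | succ k ih =>
    have hlow : Tendsto (fun n => ‖T n ^ (2 ^ k)‖ ^ 2 - ((2 ^ k : ℕ) : ℝ) * ‖T n - star (T n)‖)
        atTop (𝓝 1) := by
      simpa using (ih.pow 2).sub (hsa.const_mul ((2 ^ k : ℕ) : ℝ))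
    refine tendsto_of_tendsto_of_tendsto_of_le_of_le hlow tendsto_const_nhds (fun n => ?_)
      (fun n => hle n _)
    have h3 := norm_pow_sub_star (T n) (h1 n) (2 ^ k)
    have hP := hle n k
    have eP : T n ^ (2 ^ (k + 1)) = T n ^ (2 ^ k) * T n ^ (2 ^ k) := by
      rw [← pow_add]; congr 1; ring
    simp only
    rw [eP]
    set P := T n ^ (2 ^ k)
    have e : star P * P = P * P - (P - star P) * P := by noncomm_ring
    have h4 : ‖P‖ * ‖P‖ = ‖P * P - (P - star P) * P‖ := by
      rw [← e, CStarRing.norm_star_mul_self]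
    have h5 := norm_sub_le (P * P) ((P - star P) * P)
    have h6 := norm_mul_le (P - star P) P
    nlinarith [norm_nonneg (P - star P), norm_nonneg P]

lemma bd_spectralRadius (T : ∀ n, E n →L[ℂ] E n) (hT : ∀ n, ‖T n‖ ≤ 1)
    (h2 : Tendsto (fun n => ‖T n‖) atTop (𝓝 1))
    (hsa : Tendsto (fun n => ‖T n - star (T n)‖) atTop (𝓝 0)) :
    1 ≤ spectralRadius ℂ (bd T 1 hT) := by
  have hk : ∀ k : ℕ, 1 ≤ ‖bd T 1 hT ^ (2 ^ k)‖ := fun k =>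
    le_of_tendsto' (norm_pow_two_pow_tendsto T hT h2 hsa k) fun n => le_norm_bd_pow T 1 hT _ n
  have hg := spectrum.pow_nnnorm_pow_one_div_tendsto_nhds_spectralRadius (bd T 1 hT)
  have hg2 := hg.comp (tendsto_pow_atTop_atTop_of_one_lt (r := 2) (by norm_num))
  refine ge_of_tendsto' hg2 fun k => ?_
  simp only [Function.comp]
  apply ENNReal.one_le_rpow
  · exact_mod_cast hk k
  · positivity

end BD

section HM

open Complex in
lemma integral_exp_int (m : ℤ) :
    ∫ θ in (0 : ℝ)..(2 * Real.pi), Complex.exp (Complex.I * m * θ) =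
      if m = 0 then (2 * Real.pi : ℂ) else 0 := by
  split_ifs with h
  · subst h; simp
  · have hc : Complex.I * (m : ℂ) ≠ 0 := mul_ne_zero I_ne_zero (by exact_mod_cast h)
    rw [integral_exp_mul_complex hc]
    have : Complex.exp (Complex.I * m * ((2 * Real.pi : ℝ) : ℂ)) = 1 := by
      rw [Complex.exp_eq_one_iff]
      exact ⟨m, by push_cast; ring⟩
    rw [this]; simp

open Complex in
lemma integral_pi_sub_exp_int (m : ℤ) :
    ∫ θ in (0 : ℝ)..(2 * Real.pi), ((Real.pi - θ : ℝ) : ℂ) * Complex.exp (Complex.I * m * θ) =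
      2 * Real.pi * Complex.I * (1 / (m : ℂ)) := by
  by_cases h : m = 0
  · subst h
    simp only [Int.cast_zero, mul_zero, zero_mul, Complex.exp_zero, mul_one, div_zero]
    rw [intervalIntegral.integral_ofReal]
    rw [intervalIntegral.integral_sub (Continuous.intervalIntegrable (by fun_prop) _ _)
      (Continuous.intervalIntegrable (by fun_prop) _ _)]
    simp
    ring
  · have hm : (m : ℂ) ≠ 0 := by exact_mod_cast h
    have hc : Complex.I * (m : ℂ) ≠ 0 := mul_ne_zero I_ne_zero hm
    have hd : ∀ θ ∈ Set.uIcc (0 : ℝ) (2 * Real.pi), HasDerivAt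
        (fun θ : ℝ => ((Real.pi - θ : ℝ) : ℂ) * Complex.exp (Complex.I * m * θ) / (Complex.I * m)
          + Complex.exp (Complex.I * m * θ) / (Complex.I * m) ^ 2)
        (((Real.pi - θ : ℝ) : ℂ) * Complex.exp (Complex.I * m * θ)) θ := by
      intro θ _
      have h1 : HasDerivAt (fun θ : ℝ => Complex.exp (Complex.I * m * θ))
          (Complex.exp (Complex.I * m * θ) * (Complex.I * m * 1)) θ :=
        ((Complex.ofRealCLM.hasDerivAt (x := θ)).const_mul (Complex.I * m)).cexp
      have h2 : HasDerivAt (fun θ : ℝ => ((Real.pi - θ : ℝ) : ℂ)) (((-1 : ℝ)) : ℂ) θ := by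
        have : HasDerivAt (fun θ : ℝ => (Real.pi - θ : ℝ)) (-1) θ := by
          simpa using (hasDerivAt_id θ).const_sub Real.pi
        exact this.ofReal_comp
      have h3 := ((h2.mul h1).div_const (Complex.I * m)).add (h1.div_const ((Complex.I * m) ^ 2))
      refine h3.congr_deriv ?_
      generalize Complex.exp (Complex.I * m * θ) = w
      generalize ((Real.pi - θ : ℝ) : ℂ) = v
      generalize Complex.I * (m : ℂ) = c at hc
      field_simp
      push_cast
      ring
    rw [intervalIntegral.integral_eq_sub_of_hasDerivAt hd
      (Continuous.intervalIntegrable (by fun_prop) _ _)]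
    have : Complex.exp (Complex.I * m * ((2 * Real.pi : ℝ) : ℂ)) = 1 := by
      rw [Complex.exp_eq_one_iff]
      exact ⟨m, by push_cast; ring⟩
    rw [this]
    simp
    field_simp
    ring_nf
    simp
    try ring

/-- trigonometric polynomial -/
noncomputable def tp {n : ℕ} (x : Fin n → ℂ) (θ : ℝ) : ℂ :=
  ∑ k : Fin n, x k * Complex.exp (Complex.I * (k : ℕ) * θ)

lemma tp_cont {n : ℕ} (x : Fin n → ℂ) : Continuous (tp x) := by
  unfold tp; fun_prop

lemma integral_tp {n : ℕ} (x y : Fin n → ℂ) (w : ℝ → ℂ) (hw : Continuous w) :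
    ∫ θ in (0 : ℝ)..(2 * Real.pi), w θ * (star (tp y θ) * tp x θ) =
      ∑ j : Fin n, ∑ k : Fin n, star (y j) * x k *
        ∫ θ in (0 : ℝ)..(2 * Real.pi),
          w θ * Complex.exp (Complex.I * (((k : ℕ) - (j : ℕ) : ℤ) : ℂ) * θ) := by
  have e : ∀ θ : ℝ, w θ * (star (tp y θ) * tp x θ) = ∑ j : Fin n, ∑ k : Fin n, star (y j) * x k *
      (w θ * Complex.exp (Complex.I * (((k : ℕ) - (j : ℕ) : ℤ) : ℂ) * θ)) := by
    intro θ
    unfold tp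
    rw [star_sum, Finset.sum_mul_sum, Finset.mul_sum]
    refine Finset.sum_congr rfl fun j _ => ?_
    rw [Finset.mul_sum]
    refine Finset.sum_congr rfl fun k _ => ?_
    have : Complex.exp (Complex.I * (((k : ℕ) - (j : ℕ) : ℤ) : ℂ) * θ) =
        star (Complex.exp (Complex.I * (j : ℕ) * θ)) * Complex.exp (Complex.I * (k : ℕ) * θ) := by
      rw [Complex.star_def, ← Complex.exp_conj, ← Complex.exp_add]
      congr 1
      simp
      ring
    rw [this, star_mul']
    ring
  simp_rw [e]
  rw [intervalIntegral.integral_finsetSum]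
  · refine Finset.sum_congr rfl fun j _ => ?_
    rw [intervalIntegral.integral_finsetSum]
    · refine Finset.sum_congr rfl fun k _ => ?_
      rw [intervalIntegral.integral_const_mul]
    · intro k _
      exact Continuous.intervalIntegrable (by fun_prop) _ _
  · intro k _
    exact Continuous.intervalIntegrable (by fun_prop) _ _

lemma integral_tp_sq {n : ℕ} (x : Fin n → ℂ) :
    ∫ θ in (0 : ℝ)..(2 * Real.pi), ‖tp x θ‖ ^ 2 = 2 * Real.pi * ∑ k, ‖x k‖ ^ 2 := by
  have h := integral_tp x x (fun _ => 1) continuous_const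
  simp only [one_mul, integral_exp_int] at h
  have e : ∀ z : ℂ, star z * z = ((‖z‖ ^ 2 : ℝ) : ℂ) := by
    intro z
    rw [Complex.star_def, Complex.conj_mul']
    push_cast; rfl
  simp only [e] at h
  rw [intervalIntegral.integral_ofReal] at h
  apply Complex.ofReal_injective
  rw [h]
  have : ∀ j k : Fin n, (((k : ℕ) : ℤ) - (j : ℕ) = 0) ↔ k = j := by
    intro j k; rw [sub_eq_zero, Nat.cast_inj, Fin.val_inj]
  simp only [this]
  simp [Finset.mul_sum, Complex.mul_conj', mul_comm]

lemma hilbert_ineq {n : ℕ} (x y : Fin n → ℂ) :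
    ‖∑ j : Fin n, ∑ k : Fin n, star (y j) * x k * (1 / ((k : ℕ) - (j : ℕ) : ℂ))‖ ≤
      Real.pi / 2 * (∑ k, ‖x k‖ ^ 2 + ∑ k, ‖y k‖ ^ 2) := by
  have hpi := Real.pi_pos
  have h := integral_tp x y (fun θ => ((Real.pi - θ : ℝ) : ℂ)) (by fun_prop)
  simp only [integral_pi_sub_exp_int] at h
  set S := ∑ j : Fin n, ∑ k : Fin n, star (y j) * x k * (1 / ((k : ℕ) - (j : ℕ) : ℂ)) with hS
  have e : ∑ j : Fin n, ∑ k : Fin n, star (y j) * x k *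
      (2 * Real.pi * Complex.I * (1 / (((k : ℕ) - (j : ℕ) : ℤ) : ℂ))) =
      2 * Real.pi * Complex.I * S := by
    rw [hS, Finset.mul_sum]
    refine Finset.sum_congr rfl fun j _ => ?_
    rw [Finset.mul_sum]
    refine Finset.sum_congr rfl fun k _ => ?_
    push_cast; ring
  rw [e] at h
  have hx := tp_cont x
  have hy := tp_cont y
  have hb : ‖∫ θ in (0 : ℝ)..(2 * Real.pi), ((Real.pi - θ : ℝ) : ℂ) * (star (tp y θ) * tp x θ)‖ ≤
      ∫ θ in (0 : ℝ)..(2 * Real.pi), Real.pi / 2 * (‖tp x θ‖ ^ 2 + ‖tp y θ‖ ^ 2) := by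
    apply intervalIntegral.norm_integral_le_of_norm_le (by positivity)
    · refine Eventually.of_forall fun θ hθ => ?_
      rw [norm_mul, norm_mul, norm_star, Complex.norm_real, Real.norm_eq_abs]
      have h1 : |Real.pi - θ| ≤ Real.pi := by
        rw [abs_le]; constructor <;> linarith [hθ.1, hθ.2]
      have h2 : ‖tp y θ‖ * ‖tp x θ‖ ≤ (‖tp x θ‖ ^ 2 + ‖tp y θ‖ ^ 2) / 2 := by
        nlinarith [sq_nonneg (‖tp y θ‖ - ‖tp x θ‖)]
      calc _ ≤ Real.pi * ((‖tp x θ‖ ^ 2 + ‖tp y θ‖ ^ 2) / 2) := by gcongr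
        _ = _ := by ring
    · exact Continuous.intervalIntegrable (by fun_prop) _ _
  rw [h, intervalIntegral.integral_const_mul, intervalIntegral.integral_add
    (Continuous.intervalIntegrable (by fun_prop) _ _)
    (Continuous.intervalIntegrable (by fun_prop) _ _), integral_tp_sq, integral_tp_sq] at hb
  simp only [norm_mul, Complex.norm_I, Complex.norm_real, Real.norm_eq_abs, abs_of_pos hpi,
    Complex.norm_ofNat, mul_one] at hb
  have : 2 * Real.pi * ‖S‖ ≤ 2 * Real.pi *
      (Real.pi / 2 * (∑ k, ‖x k‖ ^ 2 + ∑ k, ‖y k‖ ^ 2)) := by linarith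
  exact le_of_mul_le_mul_left this (by positivity)

lemma opNorm_le_of_sq {F : Type*} [NormedAddCommGroup F] [InnerProductSpace ℂ F]
    (K : F →L[ℂ] F) (c : ℝ) (hc : 0 ≤ c)
    (h : ∀ x y : F, ‖(inner ℂ y (K x) : ℂ)‖ ≤ c / 2 * (‖x‖ ^ 2 + ‖y‖ ^ 2)) : ‖K‖ ≤ c := by
  refine K.opNorm_le_bound hc fun x => ?_
  rcases eq_or_ne (K x) 0 with h0 | h0
  · rw [h0, norm_zero]; positivity
  rcases eq_or_ne x 0 with hx0 | hx0
  · simp [hx0]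
  have hb : 0 < ‖K x‖ := norm_pos_iff.2 h0
  have ha : 0 < ‖x‖ := norm_pos_iff.2 hx0
  have := h x (((‖x‖ / ‖K x‖ : ℝ) : ℂ) • K x)
  rw [inner_smul_left, norm_mul, norm_smul, RCLike.norm_conj, Complex.norm_real, Real.norm_eq_abs,
    abs_of_pos (by positivity), inner_self_eq_norm_sq_to_K, norm_pow] at this
  simp only [RCLike.norm_ofReal, abs_norm] at this
  rw [div_mul_cancel₀ _ hb.ne'] at this
  have e : ‖x‖ / ‖K x‖ * ‖K x‖ ^ 2 = ‖x‖ * ‖K x‖ := by field_simp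
  rw [e] at this
  have : ‖x‖ * ‖K x‖ ≤ ‖x‖ * (c * ‖x‖) := by linarith
  exact le_of_mul_le_mul_left this ha

/-- The nilpotent Toeplitz matrix. -/
noncomputable def tM (n : ℕ) : Matrix (Fin n) (Fin n) ℂ :=
  Matrix.of fun j k => if (j : ℕ) < k then 1 / ((k : ℕ) - (j : ℕ) : ℂ) else 0

lemma tM_pow (n : ℕ) : tM n ^ n = 0 := by
  have h : (tM n).BlockTriangular id := by
    intro i j hij
    simp only [id] at hij
    simp only [tM, Matrix.of_apply]
    rw [if_neg]
    exact not_lt.2 (Fin.le_def.1 hij.le)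
  have h1 := Matrix.charpoly_of_isUpperTriangular (tM n) h
  have h2 : (tM n).charpoly = Polynomial.X ^ n := by
    rw [h1]; simp [tM]
  have h3 := Matrix.aeval_self_charpoly (tM n)
  rw [h2] at h3
  simpa using h3

/-- The corresponding operator. -/
noncomputable def tT (n : ℕ) : EuclideanSpace ℂ (Fin n) →L[ℂ] EuclideanSpace ℂ (Fin n) :=
  Matrix.toEuclideanCLM (n := Fin n) (𝕜 := ℂ) (tM n)

lemma tT_pow (n : ℕ) : tT n ^ n = 0 := by
  rw [tT, ← map_pow, tM_pow, map_zero]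

lemma inner_toCLM {n : ℕ} (A : Matrix (Fin n) (Fin n) ℂ) (x y : EuclideanSpace ℂ (Fin n)) :
    (inner ℂ y (Matrix.toEuclideanCLM (n := Fin n) (𝕜 := ℂ) A x) : ℂ) =
      ∑ j, ∑ k, star (y j) * x k * A j k := by
  rw [PiLp.inner_apply]
  refine Finset.sum_congr rfl fun j _ => ?_
  rw [Matrix.ofLp_toEuclideanCLM, Matrix.mulVec, dotProduct, RCLike.inner_apply, Finset.sum_mul]
  refine Finset.sum_congr rfl fun k _ => ?_
  rw [Complex.star_def]
  ring

lemma tT_sub_star (n : ℕ) : ‖tT n - star (tT n)‖ ≤ Real.pi := by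
  apply opNorm_le_of_sq _ _ Real.pi_pos.le
  intro x y
  have e : tT n - star (tT n) =
      Matrix.toEuclideanCLM (n := Fin n) (𝕜 := ℂ) (tM n - star (tM n)) := by
    rw [map_sub, map_star]; rfl
  rw [e, inner_toCLM, EuclideanSpace.norm_sq_eq, EuclideanSpace.norm_sq_eq]
  have e2 : ∀ j k, (tM n - star (tM n)) j k = 1 / ((k : ℕ) - (j : ℕ) : ℂ) := by
    intro j k
    simp only [tM, Matrix.sub_apply, Matrix.star_apply, Matrix.of_apply]
    rcases lt_trichotomy (j : ℕ) (k : ℕ) with h | h | h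
    · rw [if_pos h, if_neg h.not_gt]; simp
    · simp [h]
    · rw [if_neg h.not_gt, if_pos h]
      simp
      rw [← inv_neg, neg_sub]
  simp only [e2]
  exact hilbert_ineq _ _

lemma tT_lower (n : ℕ) (hn : n ≠ 0) :
    (∑ i ∈ Finset.range (n / 2), 1 / ((i : ℝ) + 1)) / 2 ≤ ‖tT n‖ := by
  set L := n / 2 with hL
  set u : EuclideanSpace ℂ (Fin n) := WithLp.toLp 2 (fun _ => 1) with hu
  have hun : ‖u‖ ^ 2 = n := by
    rw [EuclideanSpace.norm_sq_eq]; simp [hu]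
  set g : ℕ → ℕ → ℝ := fun j k => if j < k then 1 / ((k : ℝ) - j) else 0 with hg
  have hg0 : ∀ j k, 0 ≤ g j k := by
    intro j k
    simp only [hg]
    split_ifs with h
    · have : (j : ℝ) < k := by exact_mod_cast h
      apply one_div_nonneg.2; linarith
    · rfl
  have h1 : (inner ℂ u (tT n u) : ℂ) =
      ((∑ j ∈ Finset.range n, ∑ k ∈ Finset.range n, g j k : ℝ) : ℂ) := by
    rw [tT, inner_toCLM, Finset.sum_range]
    push_cast
    refine Finset.sum_congr rfl fun j _ => ?_
    rw [Finset.sum_range]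
    refine Finset.sum_congr rfl fun k _ => ?_
    simp only [hu, tM, hg, Matrix.of_apply]
    split_ifs <;> simp
  have h2 : ∀ j ∈ Finset.range (n - L), ∑ i ∈ Finset.range L, 1 / ((i : ℝ) + 1) ≤
      ∑ k ∈ Finset.range n, g j k := by
    intro j hj
    rw [Finset.mem_range] at hj
    calc ∑ i ∈ Finset.range L, 1 / ((i : ℝ) + 1) = ∑ i ∈ Finset.range L, g j (j + 1 + i) := by
          refine Finset.sum_congr rfl fun i _ => ?_
          simp only [hg]
          rw [if_pos (by omega)]
          push_cast
          congr 1; ring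
      _ = ∑ k ∈ Finset.Ico (j + 1) (j + 1 + L), g j k := by
          rw [Finset.sum_Ico_eq_sum_range]; simp
      _ ≤ _ := by
          refine Finset.sum_le_sum_of_subset_of_nonneg ?_ fun k _ _ => hg0 j k
          intro k hk
          rw [Finset.mem_Ico] at hk
          rw [Finset.mem_range]; omega
  set h := ∑ i ∈ Finset.range L, 1 / ((i : ℝ) + 1) with hh
  have hh0 : 0 ≤ h := Finset.sum_nonneg fun i _ => by positivity
  have h3 : ((n - L : ℕ) : ℝ) * h ≤ ∑ j ∈ Finset.range n, ∑ k ∈ Finset.range n, g j k := by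
    calc ((n - L : ℕ) : ℝ) * h = ∑ j ∈ Finset.range (n - L), h := by simp
      _ ≤ ∑ j ∈ Finset.range (n - L), ∑ k ∈ Finset.range n, g j k := Finset.sum_le_sum h2
      _ ≤ _ := by
        refine Finset.sum_le_sum_of_subset_of_nonneg ?_ fun j _ _ =>
          Finset.sum_nonneg fun k _ => hg0 j k
        intro k hk
        rw [Finset.mem_range] at hk ⊢; omega
  have h4 : ∑ j ∈ Finset.range n, ∑ k ∈ Finset.range n, g j k ≤ ‖tT n‖ * n := by
    have a := norm_inner_le_norm (𝕜 := ℂ) u (tT n u)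
    rw [h1, Complex.norm_real] at a
    have b := (tT n).le_opNorm u
    have c := le_abs_self (∑ j ∈ Finset.range n, ∑ k ∈ Finset.range n, g j k)
    rw [← Real.norm_eq_abs] at c
    rw [← hun]
    nlinarith [norm_nonneg u]
  have h5 : (n : ℝ) / 2 ≤ ((n - L : ℕ) : ℝ) := by
    have : n ≤ 2 * (n - L) := by omega
    have : (n : ℝ) ≤ 2 * ((n - L : ℕ) : ℝ) := by exact_mod_cast this
    linarith
  have hnp : (0 : ℝ) < n := by positivity
  have h6 : (n : ℝ) * (h / 2) ≤ n * ‖tT n‖ := by nlinarith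
  exact le_of_mul_le_mul_left h6 hnp

lemma tT_tendsto : Tendsto (fun n => ‖tT n‖) atTop atTop := by
  have h := (Real.tendsto_sum_range_one_div_nat_succ_atTop.comp
    (Nat.tendsto_div_const_atTop (n := 2) (by norm_num))).atTop_div_const (r := 2) (by norm_num)
  refine tendsto_atTop_mono' _ ?_ h
  filter_upwards [eventually_ne_atTop 0] with n hn
  exact tT_lower n hn

/-- The normalized operator. -/
noncomputable def sT (n : ℕ) : EuclideanSpace ℂ (Fin n) →L[ℂ] EuclideanSpace ℂ (Fin n) :=
  ((‖tT n‖⁻¹ : ℝ) : ℂ) • tT n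

lemma sT_norm (n : ℕ) : ‖sT n‖ = ‖tT n‖⁻¹ * ‖tT n‖ := by
  rw [sT, norm_smul, Complex.norm_real, norm_inv, norm_norm]

lemma sT_norm_le (n : ℕ) : ‖sT n‖ ≤ 1 := by
  rw [sT_norm]; exact inv_mul_le_one

lemma sT_norm_tendsto : Tendsto (fun n => ‖sT n‖) atTop (𝓝 1) := by
  refine tendsto_const_nhds.congr' ?_
  filter_upwards [tT_tendsto.eventually_gt_atTop 0] with n hn
  rw [sT_norm, inv_mul_cancel₀ hn.ne']

lemma sT_pow (n : ℕ) : sT n ^ n = 0 := by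
  rw [sT, smul_pow, tT_pow]
  ext x i
  simp

lemma sT_sa : Tendsto (fun n => ‖sT n - star (sT n)‖) atTop (𝓝 0) := by
  have h : Tendsto (fun n => ‖tT n‖⁻¹ * Real.pi) atTop (𝓝 0) := by
    simpa using tT_tendsto.inv_tendsto_atTop.mul_const Real.pi
  refine squeeze_zero (fun _ => norm_nonneg _) (fun n => ?_) h
  have : sT n - star (sT n) = ((‖tT n‖⁻¹ : ℝ) : ℂ) • (tT n - star (tT n)) := by
    rw [sT, star_smul, Complex.star_def, Complex.conj_ofReal, smul_sub]
  rw [this, norm_smul, Complex.norm_real, norm_inv, norm_norm]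
  gcongr
  exact tT_sub_star n

end HM

/-- There exist a complex Hilbert space `H` and an operator `Q ∈ B(H)` which
is s.o.t.-quasinilpotent, whose spectrum is contained in the real line, and whose spectral
radius is at least `1`; in particular `Q` is s.o.t.-quasinilpotent but not quasinilpotent. -/
theorem exists_sotQuasinilpotent_real_spectrum_spectralRadius_ge_one :
    ∃ (H : Type) (_ : NormedAddCommGroup H) (_ : InnerProductSpace ℂ H)
      (_ : CompleteSpace H) (Q : H →L[ℂ] H),
      SOTQuasinilpotent Q ∧
      (∀ z ∈ spectrum ℂ Q, z.im = 0) ∧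
      1 ≤ spectralRadius ℂ Q ∧
      spectrum ℂ Q ≠ {0} := by
  have hr := bd_spectralRadius sT sT_norm_le sT_norm_tendsto sT_sa
  refine ⟨lp (fun n : ℕ => EuclideanSpace ℂ (Fin n)) 2, inferInstance, inferInstance,
    inferInstance, bd sT 1 sT_norm_le, ?_, ?_, hr, ?_⟩
  · exact sotQuasinilpotent_of_dense _ (bd_dense sT 1 sT_norm_le sT_pow)
  · exact bd_spectrum sT 1 sT_norm_le sT_pow sT_sa
  · intro h
    unfold spectralRadius at hr
    rw [h] at hr
    simp at hr
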